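/- Let [μ, λ] be an interval in Young's lattice, and let n be the smallest integer such that μ ⊆ δ_n, where δ_n = (n, n−1, …, 2, 1) is the n-th staircase partition. If δ_{n+1} ⊆ λ, then the lattice [μ, λ] is an Eeta win if and only if path(λ) does not contain an odd-length block of east steps immediately followed by an odd-length block of north steps. -/

import Mathlib

variable {L : Type*} [PartialOrder L]

/-- `ung x` is the set `{⋀({x} ∪ T) : T ⊆ cov x}` of results of Ungar moves applied to `x`. -/
def ung (x : L) : Set L :=
  {y | ∃ T : Set L, (∀ t ∈ T, t ⋖ x) ∧ IsGLB (insert x T) y}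

lemma ung_le {x y : L} (h : y ∈ ung x) : y ≤ x := by
  obtain ⟨T, -, hglb⟩ := h
  exact hglb.1 (Set.mem_insert x T)

attribute [local instance] WellFoundedLT.toWellFoundedRelation

mutual
  /-- `x` is an Atniss win: some element of `ung x \ {x}` is an Eeta win. -/
  def atnissWin [WellFoundedLT L] (x : L) : Prop :=
    ∃ y, ∃ _ : y ∈ ung x ∧ y ≠ x, eetaWin y
  termination_by x
  decreasing_by rename_i h; exact lt_of_le_of_ne (ung_le h.1) h.2

  /-- `x` is an Eeta win: every element of `ung x \ {x}` is an Atniss win. -/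
  def eetaWin [WellFoundedLT L] (x : L) : Prop :=
    ∀ y, (y ∈ ung x ∧ y ≠ x) → atnissWin y
  termination_by x
  decreasing_by rename_i h; exact lt_of_le_of_ne (ung_le h.1) h.2
end

/-- The lattice `J(P)` of finite order ideals of a poset `P`, ordered by inclusion. -/
abbrev FinIdeal (P : Type*) [PartialOrder P] : Type _ :=
  {I : Finset P // ∀ ⦃x⦄, x ∈ I → ∀ ⦃y⦄, y ≤ x → y ∈ I}

/-- The set of maximal elements of a finite subset of a poset. -/
def maxSet {P : Type*} [PartialOrder P] (s : Finset P) : Set P :=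
  {x | x ∈ s ∧ ∀ y ∈ s, x ≤ y → x = y}

/-- A `Fintype` instance for the elements of a skew shape `l \ m`. -/
instance skewFintype {P : Type*} [DecidableEq P] (s t : Finset P) :
    Fintype {p : P // p ∈ s ∧ p ∉ t} :=
  Fintype.subtype (s \ t) (by intro x; simp [Finset.mem_sdiff])

/-- The top element of the lattice of order ideals of a finite poset `Q`. -/
def fullIdeal (Q : Type*) [PartialOrder Q] [Fintype Q] : FinIdeal Q :=
  ⟨Finset.univ, fun x _ y _ => Finset.mem_univ y⟩

/-- The `n`-th staircase partition `δ_n = (n, n-1, …, 2, 1)` as a set of boxes. -/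
def staircase (n : ℕ) : Finset (ℕ × ℕ) :=
  (Finset.range n ×ˢ Finset.range n).filter fun p => p.1 + p.2 < n

/-- The length of the `i`-th row (0-indexed) of a partition, viewed as a finite order
ideal of `ℕ × ℕ`. -/
def rowLen (I : FinIdeal (ℕ × ℕ)) (i : ℕ) : ℕ :=
  (I.val.filter fun p => p.1 = i).card

/-- Parity of the run of north steps ending at row `i` of the shape with row lengths `x`, where runs
are cut at the common points of the boundaries of `m` and `x`: the run has odd length. -/
def runOdd (m x : ℕ → ℕ) : ℕ → Prop
  | 0 => True
  | i + 1 => ¬ (x i = x (i + 1) ∧ m i < x i ∧ runOdd m x i)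

/-- Row `i` does not end an odd east run followed by an odd north run, both runs being cut at the
common points of the boundaries of `m` and `x`. -/
def RowGood (m x : ℕ → ℕ) (i : ℕ) : Prop :=
  ¬ (Odd (x i - max (x (i + 1)) (m i)) ∧ runOdd m x i)

/-- `s` is the indicator of a set of removable corners of the skew shape `x \ m`. -/
def Legal (m x s : ℕ → ℕ) : Prop :=
  ∀ i, s i = 0 ∨ (s i = 1 ∧ max (x (i + 1)) (m i) < x i)

lemma runOdd_congr {m x y : ℕ → ℕ} {i : ℕ} (h : ∀ j ≤ i, x j = y j) :
    runOdd m x i ↔ runOdd m y i := by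
  induction i with
  | zero => rfl
  | succ i ih =>
    simp only [runOdd]
    rw [ih fun j hj => h j (by omega), h i (by omega), h (i + 1) le_rfl]

lemma rowGood_congr {m x y : ℕ → ℕ} {i : ℕ} (h : ∀ j ≤ i + 1, x j = y j) :
    RowGood m x i ↔ RowGood m y i := by
  simp only [RowGood]
  rw [runOdd_congr fun j hj => h j (by omega), h i (by omega), h (i + 1) le_rfl]

/-- Some legal removal with value `c` at row `i` makes all rows above row `i` good and gives the
run at row `i` the parity prescribed by `P`. -/
def Reachable (m x : ℕ → ℕ) (i c : ℕ) (P : Prop) : Prop :=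
  ∃ s, Legal m x s ∧ (∀ j < i, RowGood m (fun k => x k - s k) j) ∧ s i = c ∧
    (runOdd m (fun k => x k - s k) i ↔ P)

lemma Reachable.step {m x : ℕ → ℕ} {i c d : ℕ} {P P' : Prop} (h : Reachable m x i c P)
    (hd : d = 0 ∨ (d = 1 ∧ max (x (i + 2)) (m (i + 1)) < x (i + 1)))
    (hgood : ¬ (Odd (x i - c - max (x (i + 1) - d) (m i)) ∧ P))
    (hP : P' ↔ ¬ (x i - c = x (i + 1) - d ∧ m i < x i - c ∧ P)) :
    Reachable m x (i + 1) d P' := by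
  obtain ⟨s, hs, hrow, hc, hrun⟩ := h
  have hne : ∀ j ≤ i, x j - s j = x j - Function.update s (i + 1) d j := by
    intro j hj
    rw [Function.update_of_ne (by omega)]
  have hrun' := (runOdd_congr (m := m) hne).symm.trans hrun
  have hi : Function.update s (i + 1) d i = c := by
    rw [Function.update_of_ne (by omega), hc]
  refine ⟨Function.update s (i + 1) d, ?_, ?_, by simp, ?_⟩
  · intro j
    by_cases hj : j = i + 1
    · subst hj
      simpa using hd
    · rw [Function.update_of_ne hj]
      exact hs j
  · intro j hj
    rcases Nat.lt_succ_iff_lt_or_eq.1 hj with hj | rfl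
    · exact (rowGood_congr fun k hk => hne k (by omega)).1 (hrow j hj)
    · simp only [RowGood, hrun', Function.update_self, hi]
      exact hgood
  · simp only [runOdd, hrun', Function.update_self, hi]
    exact hP.symm

lemma reachable_invariant {m x : ℕ → ℕ} (hx : Antitone x) (i : ℕ) :
    Reachable m x i 0 False ∨
      (Reachable m x i 0 True ∧ (max (x (i + 1)) (m i) < x i → Reachable m x i 1 True)) := by
  induction i with
  | zero =>
    refine Or.inr ⟨⟨fun _ => 0, fun _ => Or.inl rfl, by simp, rfl, Iff.rfl⟩, fun h => ?_⟩
    refine ⟨fun i => if i = 0 then 1 else 0, fun i => ?_, by simp, rfl, Iff.rfl⟩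
    by_cases hi : i = 0
    · subst hi
      exact Or.inr ⟨rfl, h⟩
    · simp [hi]
  | succ i ih =>
    have h1 : x (i + 1) ≤ x i := hx (Nat.le_succ i)
    rcases ih with h0 | ⟨h0, hr⟩
    · refine Or.inr ⟨h0.step (Or.inl rfl) (by simp) (by simp), fun h => ?_⟩
      exact h0.step (Or.inr ⟨rfl, h⟩) (by simp) (by simp)
    · by_cases hlt : max (x (i + 1)) (m i) < x i
      · have h1' := hr hlt
        by_cases hlink : m i < x (i + 1)
        · by_cases hodd : Odd (x i - x (i + 1))
          · by_cases hone : x i = x (i + 1) + 1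
            · left
              refine h1'.step (Or.inl rfl) ?_ ?_ <;> grind
            · refine Or.inr ⟨h1'.step (Or.inl rfl) ?_ ?_,
                fun h => h0.step (Or.inr ⟨rfl, h⟩) ?_ ?_⟩ <;>
                grind
          · refine Or.inr ⟨h0.step (Or.inl rfl) ?_ ?_,
              fun h => h1'.step (Or.inr ⟨rfl, h⟩) ?_ ?_⟩ <;>
              grind
        · by_cases hodd : Odd (x i - m i)
          · refine Or.inr ⟨h1'.step (Or.inl rfl) ?_ ?_,
              fun h => h1'.step (Or.inr ⟨rfl, h⟩) ?_ ?_⟩ <;>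
              grind
          · refine Or.inr ⟨h0.step (Or.inl rfl) ?_ ?_,
              fun h => h0.step (Or.inr ⟨rfl, h⟩) ?_ ?_⟩ <;>
              grind
      · by_cases hlink : m i < x (i + 1)
        · left
          refine h0.step (Or.inl rfl) ?_ ?_ <;> grind
        · refine Or.inr ⟨h0.step (Or.inl rfl) ?_ ?_,
            fun h => h0.step (Or.inr ⟨rfl, h⟩) ?_ ?_⟩ <;>
            grind

lemma exists_legal_rowGood {m x : ℕ → ℕ} (hx : Antitone x) {N : ℕ} (hN : x N = 0) :
    ∃ s, Legal m x s ∧ ∀ i, RowGood m (fun k => x k - s k) i := by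
  have key : ∃ c P, Reachable m x N c P := by
    rcases reachable_invariant (m := m) hx N with h | ⟨h, -⟩ <;> exact ⟨_, _, h⟩
  obtain ⟨c, P, s, hs, hrow, -⟩ := key
  refine ⟨s, hs, fun i => ?_⟩
  rcases lt_or_ge i N with hi | hi
  · exact hrow i hi
  · have : x i = 0 := by have := hx hi; omega
    simp [RowGood, this]

lemma legal_eq_zero_of_rowGood {m x s : ℕ → ℕ} (hx : Antitone x) {N : ℕ} (hN : x N = 0)
    (hs : Legal m x s) (hgx : ∀ i, RowGood m x i) (hgy : ∀ i, RowGood m (fun k => x k - s k) i)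
    (i : ℕ) : s i = 0 := by
  have next : ∀ i, s i = 1 → runOdd m x i → runOdd m (fun k => x k - s k) i →
      s (i + 1) = 1 ∧ x (i + 1) + 1 < x i := by
    intro i hi h1 h2
    have a := hgx i
    have b := hgy i
    simp only [RowGood, h1, h2, and_true, hi, Nat.odd_iff] at a b
    rcases hs i with h | ⟨-, h⟩
    · omega
    rcases hs (i + 1) with h' | ⟨h', h''⟩
    · rw [h'] at b
      omega
    · exact ⟨h', by omega⟩
  have inv : ∀ i, (runOdd m x i ↔ runOdd m (fun k => x k - s k) i) ∧
      (s i = 1 → runOdd m x i) := by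
    intro i
    induction i with
    | zero => simp [runOdd]
    | succ i ih =>
      obtain ⟨h1, h2⟩ := ih
      have h3 : x (i + 1) ≤ x i := hx (Nat.le_succ i)
      rcases hs i with hi | ⟨hi, -⟩
      · rcases hs (i + 1) with h' | ⟨h', h''⟩
        · simp only [runOdd, hi, h', h1]
          simp
        · have b := hgy i
          simp only [RowGood, hi, h', ← h1, Nat.odd_iff] at b
          simp only [runOdd, hi, h', ← h1]
          grind
      · obtain ⟨h', h''⟩ := next i hi (h2 hi) (h1.1 (h2 hi))
        simp only [runOdd, hi, h']
        grind
  have all : ∀ k, s i = 1 → s (i + k) = 1 := by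
    intro k hi
    induction k with
    | zero => exact hi
    | succ k ih => exact (next (i + k) ih ((inv _).2 ih) ((inv _).1.1 ((inv _).2 ih))).1
  rcases hs i with h | ⟨h, -⟩
  · exact h
  · have h1 := all N h
    have h2 : x (i + N) ≤ x N := hx (Nat.le_add_left N i)
    rcases hs (i + N) with h | ⟨-, h⟩ <;> omega

lemma mem_iff_lt_rowLen (I : FinIdeal (ℕ × ℕ)) (i j : ℕ) : (i, j) ∈ I.val ↔ j < rowLen I i := by
  have hcol : ∃ c, (I.val.filter fun p => p.1 = i).image Prod.snd = Finset.range c := by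
    classical
    have hfin : ∃ c, (i, c) ∉ I.val := by
      by_contra! h
      exact Set.infinite_univ (α := ℕ) <| (I.val.finite_toSet.preimage
        (Prod.mk_right_injective i).injOn).subset fun c _ => h c
    refine ⟨Nat.find hfin, Finset.ext fun c => ?_⟩
    simp only [Finset.mem_image, Finset.mem_filter, Prod.exists, exists_eq_right,
      Finset.mem_range, Nat.lt_find_iff, not_not]
    constructor
    · exact fun h k hk => I.2 h (Prod.mk_le_mk.2 ⟨le_rfl, hk⟩)
    · exact fun h => h c le_rfl
  obtain ⟨c, hc⟩ := hcol
  have hcard : rowLen I i = c := by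
    rw [← Finset.card_range c, ← hc, Finset.card_image_of_injOn, rowLen]
    intro p hp q hq h
    simp only [Finset.coe_filter, Set.mem_ofPred_eq] at hp hq
    exact Prod.ext (hp.2.trans hq.2.symm) h
  rw [hcard, ← Finset.mem_range, ← hc]
  simp

lemma rowLen_antitone (I : FinIdeal (ℕ × ℕ)) : Antitone (rowLen I) := by
  intro i k h
  by_contra! hlt
  have := (mem_iff_lt_rowLen I k (rowLen I i)).2 hlt
  exact lt_irrefl _ <| (mem_iff_lt_rowLen I i _).1 (I.2 this (Prod.mk_le_mk.2 ⟨h, le_rfl⟩))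

lemma exists_rowLen_eq_zero (I : FinIdeal (ℕ × ℕ)) : ∃ N, rowLen I N = 0 := by
  by_contra! h
  have h0 : ∀ i, (i, 0) ∈ I.val := fun i => (mem_iff_lt_rowLen I i 0).2 (Nat.pos_of_ne_zero (h i))
  exact Set.infinite_univ (α := ℕ) <| (I.val.finite_toSet.preimage
    (Prod.mk_left_injective 0).injOn).subset fun i _ => h0 i

lemma mem_of_covBy_of_lt {Q : Type*} [PartialOrder Q] {t I : FinIdeal Q} (h : t ⋖ I) {p q : Q}
    (hp : p < q) (hq : q ∈ I.val) : p ∈ t.val := by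
  classical
  by_contra hpt
  have hqt : q ∉ t.val := fun h => hpt (t.2 h hp.le)
  let K : FinIdeal Q := ⟨I.val.filter fun z => ¬ q ≤ z, fun z hz w hw => by
    simp only [Finset.mem_filter] at hz ⊢
    exact ⟨I.2 hz.1 hw, fun h => hz.2 (h.trans hw)⟩⟩
  have htK : t ≤ K := fun z hz =>
    Finset.mem_filter.2 ⟨h.1.le hz, fun hqz => hqt (t.2 hz hqz)⟩
  have hpK : p ∈ K.val := Finset.mem_filter.2 ⟨I.2 hq hp.le, hp.not_ge⟩
  have hKI : K ≤ I := Finset.filter_subset _ _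
  refine h.2 (lt_of_le_not_ge htK fun h => hpt (h hpK)) (lt_of_le_not_ge hKI fun h => ?_)
  exact (Finset.mem_filter.1 (h hq)).2 le_rfl

lemma mem_of_mem_ung_of_lt {Q : Type*} [PartialOrder Q] {I J : FinIdeal Q} (h : J ∈ ung I)
    {p q : Q} (hp : p < q) (hq : q ∈ I.val) : p ∈ J.val := by
  classical
  obtain ⟨T, hT, hglb⟩ := h
  let K : FinIdeal Q := ⟨I.val.filter fun z => ∃ w ∈ I.val, z < w, fun z hz y hy => by
    simp only [Finset.mem_filter] at hz ⊢
    obtain ⟨hz, w, hw, hzw⟩ := hz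
    exact ⟨I.2 hz hy, w, hw, hy.trans_lt hzw⟩⟩
  have hK : K ∈ lowerBounds (insert I T) := by
    rintro t (rfl | ht)
    · exact Finset.filter_subset _ _
    · intro z hz
      obtain ⟨-, w, hw, hzw⟩ := Finset.mem_filter.1 hz
      exact mem_of_covBy_of_lt (hT t ht) hzw hw
  exact hglb.2 hK (Finset.mem_filter.2 ⟨I.2 hq hp.le, q, hq, hp⟩)

lemma mem_ung_of_maximal {Q : Type*} [PartialOrder Q] {I J : FinIdeal Q} (hJI : J ≤ I)
    (h : ∀ p ∈ I.val, p ∉ J.val → ∀ q ∈ I.val, ¬ p < q) : J ∈ ung I := by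
  classical
  refine ⟨{t | t ⋖ I ∧ J ≤ t}, fun t ht => ht.1, ?_, ?_⟩
  · rintro t (rfl | ht)
    · exact hJI
    · exact ht.2
  · intro K hK p hp
    have hpI : p ∈ I.val := hK (Set.mem_insert _ _) hp
    by_contra hpJ
    let t : FinIdeal Q := ⟨I.val.erase p, fun z hz w hw => by
      rw [Finset.mem_erase] at hz ⊢
      refine ⟨?_, I.2 hz.2 hw⟩
      rintro rfl
      exact h w hpI hpJ z hz.2 (lt_of_le_of_ne hw (Ne.symm hz.1))⟩
    have htI : t ⋖ I := by
      refine ⟨lt_of_le_not_ge (Finset.erase_subset _ _) fun h => ?_, fun M hM hMI => ?_⟩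
      · exact (Finset.mem_erase.1 (h hpI)).1 rfl
      · by_cases hpM : p ∈ M.val
        · refine hMI.not_ge fun z hz => ?_
          by_cases hzp : z = p
          · exact hzp ▸ hpM
          · exact hM.le (Finset.mem_erase.2 ⟨hzp, hz⟩)
        · refine hM.not_ge fun z hz => Finset.mem_erase.2 ⟨?_, hMI.le hz⟩
          rintro rfl
          exact hpM hz
    have hJt : J ≤ t := fun z hz => Finset.mem_erase.2 ⟨by rintro rfl; exact hpJ hz, hJI hz⟩
    exact (Finset.mem_erase.1 (hK (Set.mem_insert_of_mem _ ⟨htI, hJt⟩) hp)).1 rfl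

section Skew

variable {μ l : FinIdeal (ℕ × ℕ)}

/-- The partition between `μ` and `l` corresponding to an order ideal of `l \ μ`. -/
def skewUnion (I : FinIdeal {p : ℕ × ℕ // p ∈ l.val ∧ p ∉ μ.val}) : FinIdeal (ℕ × ℕ) :=
  ⟨I.val.map (Function.Embedding.subtype _) ∪ μ.val, by
    intro p hp q hq
    simp only [Finset.mem_union, Finset.mem_map, Function.Embedding.subtype_apply] at hp ⊢
    by_cases hqμ : q ∈ μ.val
    · exact Or.inr hqμ
    · rcases hp with ⟨p, hp, rfl⟩ | hp
      · exact Or.inl ⟨⟨q, l.2 p.2.1 hq, hqμ⟩, I.2 hp hq, rfl⟩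
      · exact absurd (μ.2 hp hq) hqμ⟩

lemma mem_skewUnion {I : FinIdeal {p : ℕ × ℕ // p ∈ l.val ∧ p ∉ μ.val}} {p : ℕ × ℕ} :
    p ∈ (skewUnion I).val ↔ (∃ h, (⟨p, h⟩ : {p : ℕ × ℕ // p ∈ l.val ∧ p ∉ μ.val}) ∈ I.val) ∨
      p ∈ μ.val := by
  simp [skewUnion]

lemma mem_iff_lt_rowLen_skewUnion (I : FinIdeal {p : ℕ × ℕ // p ∈ l.val ∧ p ∉ μ.val})
    (p : {p : ℕ × ℕ // p ∈ l.val ∧ p ∉ μ.val}) :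
    p ∈ I.val ↔ p.1.2 < rowLen (skewUnion I) p.1.1 := by
  rw [← mem_iff_lt_rowLen, mem_skewUnion]
  constructor
  · exact fun h => Or.inl ⟨p.2, h⟩
  · rintro (⟨_, h⟩ | h)
    · exact h
    · exact absurd h p.2.2

lemma rowLen_le_rowLen_skewUnion (I : FinIdeal {p : ℕ × ℕ // p ∈ l.val ∧ p ∉ μ.val}) (i : ℕ) :
    rowLen μ i ≤ rowLen (skewUnion I) i := by
  by_contra! h
  have h1 := mem_skewUnion (I := I).2 (Or.inr ((mem_iff_lt_rowLen μ i _).2 h))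
  exact lt_irrefl _ ((mem_iff_lt_rowLen _ _ _).1 h1)

lemma exists_mem_of_lt_rowLen (I : FinIdeal {p : ℕ × ℕ // p ∈ l.val ∧ p ∉ μ.val}) {i j : ℕ}
    (h : rowLen μ i ≤ j) (h' : j < rowLen (skewUnion I) i) :
    ∃ hp, (⟨(i, j), hp⟩ : {p : ℕ × ℕ // p ∈ l.val ∧ p ∉ μ.val}) ∈ I.val := by
  rcases mem_skewUnion.1 ((mem_iff_lt_rowLen (skewUnion I) i j).2 h') with h1 | h1
  · exact h1
  · have := (mem_iff_lt_rowLen μ i j).1 h1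
    omega

lemma exists_legal_of_mem_ung {I J : FinIdeal {p : ℕ × ℕ // p ∈ l.val ∧ p ∉ μ.val}}
    (hJ : J ∈ ung I) (hne : J ≠ I) :
    ∃ s, Legal (rowLen μ) (rowLen (skewUnion I)) s ∧
      rowLen (skewUnion J) = (fun k => rowLen (skewUnion I) k - s k) ∧ ∃ i, s i ≠ 0 := by
  have hle : ∀ i, rowLen (skewUnion J) i ≤ rowLen (skewUnion I) i := by
    intro i
    by_contra! h
    obtain ⟨hp, h1⟩ := exists_mem_of_lt_rowLen J (rowLen_le_rowLen_skewUnion I i) h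
    exact lt_irrefl _ ((mem_iff_lt_rowLen_skewUnion I _).1 (ung_le hJ h1))
  have hlt : ∀ i k, i ≤ k → rowLen (skewUnion J) i < rowLen (skewUnion I) i →
      ∀ j, rowLen (skewUnion J) i ≤ j → j < rowLen (skewUnion I) k →
      k = i ∧ j = rowLen (skewUnion J) i := by
    intro i k hik h j hj hjk
    have hμi := rowLen_le_rowLen_skewUnion J i
    have hμk := rowLen_antitone μ hik
    obtain ⟨hp, h1⟩ := exists_mem_of_lt_rowLen I hμi h
    obtain ⟨hq, h2⟩ := exists_mem_of_lt_rowLen I (by omega) hjk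
    by_contra hcon
    refine lt_irrefl _ ((mem_iff_lt_rowLen_skewUnion J _).1
      (mem_of_mem_ung_of_lt (p := ⟨_, hp⟩) hJ (lt_of_le_of_ne ?_ ?_) h2))
    · exact Prod.mk_le_mk.2 ⟨hik, hj⟩
    · intro heq
      simp only [Subtype.mk.injEq, Prod.mk.injEq] at heq
      exact hcon ⟨heq.1.symm, heq.2.symm⟩
  refine ⟨fun i => rowLen (skewUnion I) i - rowLen (skewUnion J) i, fun i => ?_, ?_, ?_⟩
  · have h1 := hle i
    have h2 := rowLen_le_rowLen_skewUnion J i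
    dsimp only
    by_cases h : rowLen (skewUnion J) i = rowLen (skewUnion I) i
    · left
      omega
    · have h3 := hlt i i le_rfl (by omega) (rowLen (skewUnion I) i - 1)
      have h4 := hlt i (i + 1) (by omega) (by omega) (rowLen (skewUnion J) i) le_rfl
      right
      omega
  · funext i
    have h1 := hle i
    dsimp only
    omega
  · by_contra! h
    refine hne (le_antisymm (ung_le hJ) fun p hp => ?_)
    rw [mem_iff_lt_rowLen_skewUnion] at hp ⊢
    have h1 := h p.1.1
    have h2 := hle p.1.1
    omega

lemma exists_mem_ung_of_legal (I : FinIdeal {p : ℕ × ℕ // p ∈ l.val ∧ p ∉ μ.val}) {s : ℕ → ℕ}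
    (hs : Legal (rowLen μ) (rowLen (skewUnion I)) s) {i : ℕ} (hi : s i ≠ 0) :
    ∃ J, (J ∈ ung I ∧ J ≠ I) ∧
      rowLen (skewUnion J) = fun k => rowLen (skewUnion I) k - s k := by
  have hanti : ∀ i k, i ≤ k → rowLen (skewUnion I) k - s k ≤ rowLen (skewUnion I) i - s i := by
    intro i k hik
    rcases hik.eq_or_lt with rfl | hlt
    · rfl
    · have h1 := rowLen_antitone (skewUnion I) hik
      have h2 := rowLen_antitone (skewUnion I) (Nat.succ_le_of_lt hlt)
      simp only [Nat.succ_eq_add_one] at h2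
      rcases hs i with h | ⟨h, h'⟩ <;> omega
  let J : FinIdeal {p : ℕ × ℕ // p ∈ l.val ∧ p ∉ μ.val} :=
    ⟨I.val.filter fun p => p.1.2 < rowLen (skewUnion I) p.1.1 - s p.1.1, fun p hp q hq => by
      rw [Finset.mem_filter] at hp ⊢
      have hq' : q.1.1 ≤ p.1.1 ∧ q.1.2 ≤ p.1.2 := hq
      exact ⟨I.2 hp.1 hq, by have := hanti _ _ hq'.1; omega⟩⟩
  have hJ : ∀ p, p ∈ J.val ↔ p.1.2 < rowLen (skewUnion I) p.1.1 - s p.1.1 := by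
    intro p
    refine ⟨fun h => (Finset.mem_filter.1 h).2, fun h => Finset.mem_filter.2 ⟨?_, h⟩⟩
    rw [mem_iff_lt_rowLen_skewUnion]
    omega
  have hrow : rowLen (skewUnion J) = fun k => rowLen (skewUnion I) k - s k := by
    have hμ : ∀ k, rowLen μ k ≤ rowLen (skewUnion I) k - s k := by
      intro k
      have := rowLen_le_rowLen_skewUnion I k
      rcases hs k with h | ⟨h, h'⟩ <;> omega
    funext k
    refine le_antisymm ?_ ?_ <;> by_contra! h
    · obtain ⟨hp, h1⟩ := exists_mem_of_lt_rowLen J (hμ k) h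
      exact lt_irrefl _ ((hJ _).1 h1)
    · obtain ⟨hp, -⟩ := exists_mem_of_lt_rowLen I (rowLen_le_rowLen_skewUnion J k)
        (h.trans_le (Nat.sub_le _ _))
      exact lt_irrefl _ ((mem_iff_lt_rowLen_skewUnion J _).1 ((hJ ⟨_, hp⟩).2 h))
  refine ⟨J, ⟨mem_ung_of_maximal (Finset.filter_subset _ _) ?_, ?_⟩, hrow⟩
  · intro p hp hpJ q hq hpq
    rw [hJ] at hpJ
    rw [mem_iff_lt_rowLen_skewUnion] at hp hq
    have hle : p.1.1 ≤ q.1.1 ∧ p.1.2 ≤ q.1.2 := hpq.le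
    rcases hle.1.eq_or_lt with h | h
    · rw [← h] at hq
      rcases hs p.1.1 with h' | ⟨h', -⟩
      · omega
      · exact hpq.ne (Subtype.ext (Prod.ext h (by omega)))
    · have h2 := rowLen_antitone (skewUnion I) (Nat.succ_le_of_lt h)
      simp only [Nat.succ_eq_add_one] at h2
      rcases hs p.1.1 with h' | ⟨h', h''⟩ <;> omega
  · intro h
    have h1 := congrFun hrow i
    rw [h] at h1
    rcases hs i with h' | ⟨h', h''⟩ <;> omega

/-- The winner of the Ungar game on any interval `[μ, l]` in Young's lattice. -/
lemma eetaWin_iff_forall_rowGood (I : FinIdeal {p : ℕ × ℕ // p ∈ l.val ∧ p ∉ μ.val}) :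
    (eetaWin I ↔ ∀ i, RowGood (rowLen μ) (rowLen (skewUnion I)) i) ∧
      (atnissWin I ↔ ¬ ∀ i, RowGood (rowLen μ) (rowLen (skewUnion I)) i) := by
  induction I using WellFoundedLT.induction with
  | ind I ih =>
    have hx := rowLen_antitone (skewUnion I)
    obtain ⟨N, hN⟩ := exists_rowLen_eq_zero (skewUnion I)
    have lt : ∀ J, J ∈ ung I ∧ J ≠ I → J < I := fun J h => lt_of_le_of_ne (ung_le h.1) h.2
    have good_imp : (∀ i, RowGood (rowLen μ) (rowLen (skewUnion I)) i) →
        ∀ J, J ∈ ung I ∧ J ≠ I → ¬ ∀ i, RowGood (rowLen μ) (rowLen (skewUnion J)) i := by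
      intro hg J hJ hgJ
      obtain ⟨s, hs, hrow, i, hi⟩ := exists_legal_of_mem_ung hJ.1 hJ.2
      rw [hrow] at hgJ
      exact hi (legal_eq_zero_of_rowGood hx hN hs hg hgJ i)
    have not_good_imp : (¬ ∀ i, RowGood (rowLen μ) (rowLen (skewUnion I)) i) →
        ∃ J, (J ∈ ung I ∧ J ≠ I) ∧ ∀ i, RowGood (rowLen μ) (rowLen (skewUnion J)) i := by
      intro hg
      obtain ⟨s, hs, hgood⟩ := exists_legal_rowGood (m := rowLen μ) hx hN
      have hne : ∃ i, s i ≠ 0 := by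
        by_contra! h
        exact hg (by simpa [h] using hgood)
      obtain ⟨i, hi⟩ := hne
      obtain ⟨J, hJ, hrow⟩ := exists_mem_ung_of_legal I hs hi
      exact ⟨J, hJ, by rwa [hrow]⟩
    constructor
    · rw [eetaWin]
      constructor
      · intro h
        by_contra hg
        obtain ⟨J, hJ, hgJ⟩ := not_good_imp hg
        exact (ih J (lt J hJ)).2.1 (h J hJ) hgJ
      · exact fun hg J hJ => (ih J (lt J hJ)).2.2 (good_imp hg J hJ)
    · rw [atnissWin]
      constructor
      · rintro ⟨J, hJ, hwin⟩ hg
        exact good_imp hg J hJ ((ih J (lt J hJ)).1.1 hwin)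
      · intro hg
        obtain ⟨J, hJ, hgJ⟩ := not_good_imp hg
        exact ⟨J, hJ, (ih J (lt J hJ)).1.2 hgJ⟩

lemma skewUnion_fullIdeal (hμl : μ ≤ l) :
    skewUnion (fullIdeal {p : ℕ × ℕ // p ∈ l.val ∧ p ∉ μ.val}) = l := by
  refine Subtype.ext (Finset.ext fun p => ?_)
  rw [mem_skewUnion]
  constructor
  · rintro (⟨h, -⟩ | h)
    · exact h.1
    · exact hμl h
  · intro h
    by_cases hp : p ∈ μ.val
    · exact Or.inr hp
    · exact Or.inl ⟨⟨h, hp⟩, Finset.mem_univ _⟩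

end Skew

lemma exists_run_start {m x : ℕ → ℕ} (h : ∀ i, x i ≠ 0 → m i < x i) (hx : Antitone x) (j : ℕ)
    (hj : x j ≠ 0) :
    ∃ i ≤ j, x i = x j ∧ (i = 0 ∨ x i < x (i - 1)) ∧ (runOdd m x j ↔ Odd (j - i + 1)) := by
  induction j with
  | zero => exact ⟨0, le_rfl, rfl, Or.inl rfl, by simp [runOdd]⟩
  | succ j ih =>
    have h1 : x (j + 1) ≤ x j := hx (Nat.le_succ j)
    by_cases heq : x j = x (j + 1)
    · obtain ⟨i, hij, hi, hstart, hrun⟩ := ih (by omega)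
      refine ⟨i, by omega, by omega, hstart, ?_⟩
      have hm := h j (by omega)
      simp only [runOdd, heq, hrun, true_and]
      rw [heq] at hm
      simp only [hm, true_and, Nat.odd_iff]
      omega
    · refine ⟨j + 1, le_rfl, rfl, Or.inr ?_, ?_⟩
      · simp only [Nat.add_sub_cancel]
        omega
      · simp [runOdd, heq]

lemma run_start_unique {x : ℕ → ℕ} (hx : Antitone x) {i k : ℕ} (hik : x i = x k)
    (hi : i = 0 ∨ x i < x (i - 1)) (hk : k = 0 ∨ x k < x (k - 1)) : i = k := by
  rcases lt_trichotomy i k with h | h | h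
  · have := hx (show i ≤ k - 1 by omega)
    omega
  · exact h
  · have := hx (show k ≤ i - 1 by omega)
    omega

lemma mem_staircase {n i j : ℕ} : (i, j) ∈ staircase n ↔ i + j < n := by
  simp only [staircase, Finset.mem_filter, Finset.mem_product, Finset.mem_range]
  omega

/-- Let `[μ, l]` be an interval in Young's lattice `J(ℕ × ℕ)` and let `n` be the
smallest integer with `μ ⊆ δ_n`.  If `δ_{n+1} ⊆ l`, then the lattice `[μ, l] ≅ J(l \ μ)`
is an Eeta win if and only if `path(l)` contains no odd-length maximal block of east steps
immediately followed by an odd-length maximal block of north steps (expressed via row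
lengths as in the Young's lattice characterization). -/
theorem eetaWin_interval_young_iff (μ l : FinIdeal (ℕ × ℕ)) (hμl : μ ≤ l) (n : ℕ)
    (hn : μ.val ⊆ staircase n) (hn' : ∀ m < n, ¬ μ.val ⊆ staircase m)
    (hl : staircase (n + 1) ⊆ l.val) :
    eetaWin (fullIdeal {p : ℕ × ℕ // p ∈ l.val ∧ p ∉ μ.val}) ↔
      ¬ ∃ i j : ℕ, i ≤ j ∧ rowLen l i = rowLen l j ∧
        rowLen l (j + 1) < rowLen l j ∧
        (i = 0 ∨ rowLen l i < rowLen l (i - 1)) ∧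
        Odd (j - i + 1) ∧ Odd (rowLen l j - rowLen l (j + 1)) := by
  have hx := rowLen_antitone l
  have hμ : ∀ i, rowLen μ i = 0 ∨ i + rowLen μ i ≤ n := by
    intro i
    by_contra! h
    have h1 := hn ((mem_iff_lt_rowLen μ i (rowLen μ i - 1)).2 (by omega))
    rw [mem_staircase] at h1
    omega
  have hl' : ∀ i, n + 1 ≤ i + rowLen l i := by
    intro i
    by_contra! h
    exact lt_irrefl _ ((mem_iff_lt_rowLen l i _).1 (hl (mem_staircase.2 h)))
  have hlt : ∀ i, rowLen l i ≠ 0 → rowLen μ i < rowLen l i := by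
    intro i hi
    have h1 := hμ i
    have h2 := hl' i
    omega
  have hmax : ∀ i, max (rowLen l (i + 1)) (rowLen μ i) = rowLen l (i + 1) := by
    intro i
    have h1 := hμ i
    have h2 := hl' (i + 1)
    omega
  rw [(eetaWin_iff_forall_rowGood _).1, skewUnion_fullIdeal hμl]
  simp only [RowGood, hmax]
  rw [← not_exists, not_iff_not]
  constructor
  · rintro ⟨j, hodd, hrun⟩
    have hpos := hodd.pos
    obtain ⟨i, hij, hi, hstart, hiff⟩ := exists_run_start hlt hx j (by omega)
    exact ⟨i, j, hij, hi, by omega, hstart, hiff.1 hrun, hodd⟩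
  · rintro ⟨i, j, hij, hi, hj, hstart, hodd, hodd'⟩
    obtain ⟨k, hkj, hk, hstart', hiff⟩ := exists_run_start hlt hx j (by omega)
    obtain rfl := run_start_unique hx (hi.trans hk.symm) hstart hstart'
    exact ⟨j, hodd', hiff.2 hodd⟩
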